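/- Let n ≥ 2 be an integer and let Φ, η : ℝ^{n-1} → ℝ be Schwartz functions. Then ∫_{ℝ^{n-1}} Σ_{j=1}^{n-1} ( x_j ∂_{x_j}Φ(x) ∂_{x_1}η(x) − x_j ∂_{x_1}Φ(x) ∂_{x_j}η(x) ) dx = (2 − n) ∫_{ℝ^{n-1}} Φ(x) ∂_{x_1}η(x) dx. (Applied with Φ(x) = φ(x, η(x)), this evaluates the term I₁ in the proof of the Pohozaev relation.) -/

import Mathlib

open MeasureTheory Filter

noncomputable section

/-- `i`-th partial derivative of a function on `ℝ^m`. -/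
def pdH {m : ℕ} (f : EuclideanSpace ℝ (Fin m) → ℝ) (i : Fin m)
    (x : EuclideanSpace ℝ (Fin m)) : ℝ :=
  fderiv ℝ f x (EuclideanSpace.single i 1)

/-- `|∇f|²` for a function on `ℝ^m`. -/
def gradSqH {m : ℕ} (f : EuclideanSpace ℝ (Fin m) → ℝ) (x : EuclideanSpace ℝ (Fin m)) : ℝ :=
  ∑ i, (pdH f i x) ^ 2

/-- `i`-th horizontal partial derivative of a function on `ℝ^m × ℝ`. -/
def pdX {m : ℕ} (f : EuclideanSpace ℝ (Fin m) × ℝ → ℝ) (i : Fin m)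
    (p : EuclideanSpace ℝ (Fin m) × ℝ) : ℝ :=
  fderiv ℝ f p (EuclideanSpace.single i 1, 0)

/-- vertical partial derivative of a function on `ℝ^m × ℝ`. -/
def pdY {m : ℕ} (f : EuclideanSpace ℝ (Fin m) × ℝ → ℝ)
    (p : EuclideanSpace ℝ (Fin m) × ℝ) : ℝ :=
  fderiv ℝ f p (0, 1)

/-- `|∇f|²` for a function on `ℝ^m × ℝ`. -/
def gradSq {m : ℕ} (f : EuclideanSpace ℝ (Fin m) × ℝ → ℝ)
    (p : EuclideanSpace ℝ (Fin m) × ℝ) : ℝ :=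
  (∑ i, (pdX f i p) ^ 2) + (pdY f p) ^ 2

/-- Laplacian of a function on `ℝ^m × ℝ`. -/
def lap {m : ℕ} (f : EuclideanSpace ℝ (Fin m) × ℝ → ℝ)
    (p : EuclideanSpace ℝ (Fin m) × ℝ) : ℝ :=
  (∑ i, pdX (pdX f i) i p) + pdY (pdY f) p

/-- the mean-curvature operator `∇·(∇η/√(1+|∇η|²))`. -/
def meanCurv {m : ℕ} (η : EuclideanSpace ℝ (Fin m) → ℝ) (x : EuclideanSpace ℝ (Fin m)) : ℝ :=
  ∑ i, pdH (fun x' => pdH η i x' / Real.sqrt (1 + gradSqH η x')) i x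

/-- the fluid domain `Ω = {(x, y) : y < η x}` for deep water. -/
def Omega {m : ℕ} (η : EuclideanSpace ℝ (Fin m) → ℝ) :
    Set (EuclideanSpace ℝ (Fin m) × ℝ) :=
  {p | p.2 < η p.1}

/-- the deep-water solitary wave problem with gravity `g`, surface tension `T`
and wave speed `c`: Laplace's equation in `Ω`, the kinematic and dynamic boundary
conditions on `Γ`, and decay of `η` and `φ` at infinity. -/
def SolvesDW {m : ℕ} (g T : ℝ) (c : EuclideanSpace ℝ (Fin m))
    (η : EuclideanSpace ℝ (Fin m) → ℝ) (φ : EuclideanSpace ℝ (Fin m) × ℝ → ℝ) : Prop :=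
  (∀ p ∈ Omega η, lap φ p = 0) ∧
  (∀ x, pdY φ (x, η x) = ∑ i, (pdX φ i (x, η x) - c i) * pdH η i x) ∧
  (∀ x, (1 / 2) * gradSq φ (x, η x) - (∑ i, c i * pdX φ i (x, η x)) + g * η x
      = T * meanCurv η x) ∧
  Tendsto η (cocompact (EuclideanSpace ℝ (Fin m))) (nhds 0) ∧
  Tendsto φ (cocompact (EuclideanSpace ℝ (Fin m) × ℝ) ⊓ 𝓟 (closure (Omega η))) (nhds 0)

namespace SchwartzMap

open scoped LineDeriv

section Derivative

variable {E : Type*} [NormedAddCommGroup E] [NormedSpace ℝ E]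

/-- Directional derivatives of a Schwartz function commute. -/
theorem lineDerivOp_lineDerivOp_comm (v w : E) (f : 𝓢(E, ℝ)) :
    ∂_{v} (∂_{w} f) = ∂_{w} (∂_{v} f) := by
  ext x
  have hf : IsSymmSndFDerivAt ℝ f x :=
    (f.smooth 2).contDiffAt.isSymmSndFDerivAt (by simp)
  have hd : DifferentiableAt ℝ (fderiv ℝ f) x := (fderivCLM ℝ E ℝ f).differentiableAt
  have hsnd (a b : E) : ∂_{a} (∂_{b} f) x = fderiv ℝ (fderiv ℝ f) x a b := by
    change fderiv ℝ (fun y ↦ fderiv ℝ f y b) x a = _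
    rw [fderiv_clm_apply hd (differentiableAt_const b)]
    simp
  rw [hsnd, hsnd, hf.eq]

/-- The Leibniz rule for the product of a continuous linear functional and a Schwartz function. -/
theorem lineDerivOp_smulLeftCLM_clm (L : E →L[ℝ] ℝ) (v : E) (f : 𝓢(E, ℝ)) :
    ∂_{v} (smulLeftCLM ℝ L f) = L v • f + smulLeftCLM ℝ L (∂_{v} f) := by
  ext x
  have hL : (L : E → ℝ).HasTemperateGrowth := L.hasTemperateGrowth
  rw [lineDerivOp_apply_eq_fderiv, smulLeftCLM_apply hL,
    fderiv_fun_smul L.differentiableAt f.differentiableAt]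
  simp [hL, lineDerivOp_apply_eq_fderiv]
  ring

end Derivative

variable {E : Type*} [NormedAddCommGroup E] [NormedSpace ℝ E] [FiniteDimensional ℝ E]
  [MeasurableSpace E] [BorelSpace E] {μ : Measure E} [μ.IsAddHaarMeasure]

theorem integrable_mul (f g : 𝓢(E, ℝ)) : Integrable (fun x ↦ f x * g x) μ :=
  (pairing (ContinuousLinearMap.mul ℝ ℝ) f g).integrable

theorem integrable_clm_mul_mul (L : E →L[ℝ] ℝ) (f g : 𝓢(E, ℝ)) :
    Integrable (fun x ↦ L x * f x * g x) μ := by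
  simpa [L.hasTemperateGrowth] using integrable_mul (μ := μ) (smulLeftCLM ℝ L f) g

/-- Integration by parts against a linear weight. -/
theorem integral_clm_mul_lineDerivOp_mul (L : E →L[ℝ] ℝ) (v : E) (f g : 𝓢(E, ℝ)) :
    ∫ x, L x * ∂_{v} f x * g x ∂μ
      = -(L v * ∫ x, f x * g x ∂μ) - ∫ x, L x * f x * ∂_{v} g x ∂μ := by
  have hL : (L : E → ℝ).HasTemperateGrowth := L.hasTemperateGrowth
  have hparts := integral_mul_lineDerivOp_right_eq_neg_left (μ := μ) f (smulLeftCLM ℝ L g) v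
  have hleft : ∫ x, ∂_{v} f x * smulLeftCLM ℝ L g x ∂μ = ∫ x, L x * ∂_{v} f x * g x ∂μ :=
    integral_congr_ae (.of_forall fun x ↦ by simp [hL]; ring)
  have hright : ∫ x, f x * ∂_{v} (smulLeftCLM ℝ L g) x ∂μ
      = L v * ∫ x, f x * g x ∂μ + ∫ x, L x * f x * ∂_{v} g x ∂μ := by
    rw [← integral_const_mul, ← integral_add ((integrable_mul f g).const_mul _)
      (integrable_clm_mul_mul L f _), lineDerivOp_smulLeftCLM_clm]
    exact integral_congr_ae (.of_forall fun x ↦ by simp [hL]; ring)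
  rw [hleft, hright] at hparts
  linarith

theorem integrable_clm_mul_lineDerivOp_sub (L : E →L[ℝ] ℝ) (v w : E) (f g : 𝓢(E, ℝ)) :
    Integrable (fun x ↦ L x * ∂_{v} f x * ∂_{w} g x - L x * ∂_{w} f x * ∂_{v} g x) μ :=
  (integrable_clm_mul_mul L _ _).sub (integrable_clm_mul_mul L _ _)

/-- The antisymmetrized product of two directional derivatives with a linear weight integrates to
a combination of terms of first order. -/
theorem integral_clm_mul_lineDerivOp_sub (L : E →L[ℝ] ℝ) (v w : E) (f g : 𝓢(E, ℝ)) :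
    ∫ x, (L x * ∂_{v} f x * ∂_{w} g x - L x * ∂_{w} f x * ∂_{v} g x) ∂μ
      = L w * ∫ x, f x * ∂_{v} g x ∂μ - L v * ∫ x, f x * ∂_{w} g x ∂μ := by
  rw [integral_sub (integrable_clm_mul_mul L _ _) (integrable_clm_mul_mul L _ _),
    integral_clm_mul_lineDerivOp_mul, integral_clm_mul_lineDerivOp_mul,
    lineDerivOp_lineDerivOp_comm w v]
  ring

end SchwartzMap

open SchwartzMap in
/-- evaluation of the integral `I₁`. -/
theorem schwartz_I1_identity
    (n : ℕ) (hn : 2 ≤ n)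
    (Φ η : 𝓢(EuclideanSpace ℝ (Fin (n - 1)), ℝ)) :
    ∫ x, ∑ j, (x j * pdH (⇑Φ) j x * pdH (⇑η) (⟨0, by omega⟩ : Fin (n - 1)) x
        - x j * pdH (⇑Φ) (⟨0, by omega⟩ : Fin (n - 1)) x * pdH (⇑η) j x)
      = ((2 : ℝ) - n) * ∫ x, Φ x * pdH (⇑η) (⟨0, by omega⟩ : Fin (n - 1)) x := by
  set i : Fin (n - 1) := ⟨0, by omega⟩
  let e (j : Fin (n - 1)) : EuclideanSpace ℝ (Fin (n - 1)) := EuclideanSpace.single j 1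
  have hterm (j : Fin (n - 1)) := integral_clm_mul_lineDerivOp_sub (μ := volume)
    (EuclideanSpace.proj (𝕜 := ℝ) j) (e j) (e i) Φ η
  have hint (j : Fin (n - 1)) := integrable_clm_mul_lineDerivOp_sub (μ := volume)
    (EuclideanSpace.proj (𝕜 := ℝ) j) (e j) (e i) Φ η
  calc
    _ = ∑ j, ((if j = i then ∫ x, Φ x * pdH η j x else 0) - ∫ x, Φ x * pdH η i x) := by
      refine (integral_finsetSum _ fun j _ ↦ hint j).trans ?_
      refine Finset.sum_congr rfl fun j _ ↦ (hterm j).trans ?_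
      simp [e, lineDerivOp_apply_eq_fderiv, pdH]
    _ = _ := by
      have hcast : ((n - 1 : ℕ) : ℝ) = n - 1 := by
        rw [Nat.cast_sub (by omega), Nat.cast_one]
      simp [Finset.sum_sub_distrib, hcast]
      ring
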